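/- arXiv:1910.03374 — 3 statements merged into one kernel-verified Lean document; each statement's English description precedes it below -/
import Mathlib

section
/- Let f : ℝⁿ → ℝ be continuous and let δ > 0. Then the δ-smoothing f̂_δ(x) = E_{u∼Bⁿ}[f(x + δu)] is differentiable, and its gradient is given by the sphere-sampling formula ∇f̂_δ(x) = E_{u∼Sⁿ}[ (n/δ) f(x + δu) u ], where u ∼ Sⁿ denotes a vector drawn uniformly from the unit Euclidean sphere in ℝⁿ. -/
open MeasureTheory

/-- The uniform probability measure on the closed unit Euclidean ball in `ℝⁿ`. -/
noncomputable def uniformUnitBall (n : ℕ) : Measure (EuclideanSpace ℝ (Fin n)) :=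
  (volume (Metric.closedBall (0 : EuclideanSpace ℝ (Fin n)) 1))⁻¹ •
    volume.restrict (Metric.closedBall (0 : EuclideanSpace ℝ (Fin n)) 1)

/-- The uniform probability measure on the unit Euclidean sphere in `ℝⁿ`, defined as the
normalized `(n−1)`-dimensional Hausdorff measure restricted to the sphere. -/
noncomputable def uniformUnitSphere (n : ℕ) : Measure (EuclideanSpace ℝ (Fin n)) :=
  ((μH[(n : ℝ) - 1]) (Metric.sphere (0 : EuclideanSpace ℝ (Fin n)) 1))⁻¹ •
    (μH[(n : ℝ) - 1]).restrict (Metric.sphere (0 : EuclideanSpace ℝ (Fin n)) 1)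

/-- The `δ`-smoothing `f̂_δ(x) = E_{u ∼ Bⁿ}[f(x + δu)]` of a function `f : ℝⁿ → ℝ`. -/
noncomputable def deltaSmoothed (n : ℕ) (f : EuclideanSpace ℝ (Fin n) → ℝ) (δ : ℝ)
    (x : EuclideanSpace ℝ (Fin n)) : ℝ :=
  ∫ u, f (x + δ • u) ∂(uniformUnitBall n)

open Set Filter Metric Topology Module
open scoped ENNReal NNReal RealInnerProductSpace Pointwise

/-- If every ball of each radius `u k → 0` has constant `μ`-measure `φ (u k)` and constant
`ν`-measure `ψ (u k) ≥ φ (u k)`, then `μ ≤ ν` on open sets. -/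
theorem measure_le_of_isOpen_of_measure_ball_le {X : Type*} [PseudoMetricSpace X]
    [SecondCountableTopology X] [MeasurableSpace X] [BorelSpace X] (μ ν : Measure X)
    [IsFiniteMeasure μ] [IsFiniteMeasure ν] [ν.IsOpenPosMeasure] {φ ψ : ℝ → ℝ≥0∞}
    (hμ : ∀ x r, μ (ball x r) = φ r) (hν : ∀ x r, ν (ball x r) = ψ r) {u : ℕ → ℝ}
    (hu : ∀ k, 0 < u k) (hu0 : Tendsto u atTop (𝓝 0)) (hle : ∀ k, φ (u k) ≤ ψ (u k))
    {U : Set X} (hU : IsOpen U) : μ U ≤ ν U := by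
  rcases isEmpty_or_nonempty X with hX | ⟨⟨x₀⟩⟩
  · simp [eq_empty_of_isEmpty U]
  have hψ0 : ∀ k, ψ (u k) ≠ 0 := fun k ↦
    hν x₀ (u k) ▸ (measure_ball_pos ν x₀ (hu k)).ne'
  have hψt : ∀ k, ψ (u k) ≠ ∞ := fun k ↦ hν x₀ (u k) ▸ measure_ne_top ν _
  let s : ℝ → Set (X × X) := fun r ↦ {p | p.2 ∈ U ∧ dist p.2 p.1 < r}
  have hs : ∀ r, MeasurableSet (s r) := fun r ↦
    (hU.measurableSet.preimage measurable_snd).inter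
      (isOpen_lt (continuous_snd.dist continuous_fst) continuous_const).measurableSet
  have hs_slice : ∀ r x, Prod.mk x ⁻¹' s r = U ∩ ball x r := fun r x ↦ rfl
  have hmeas : ∀ r, Measurable fun x ↦ ν (U ∩ ball x r) := fun r ↦
    measurable_measure_prodMk_left (hs r)
  have hint : ∀ r, ∫⁻ x, ν (U ∩ ball x r) ∂μ = φ r * ν U := by
    intro r
    have h := (Measure.prod_apply (μ := μ) (ν := ν) (hs r)).symm
    rw [Measure.prod_apply_symm (hs r)] at h
    have hy : ∀ y, μ ((fun x ↦ (x, y)) ⁻¹' s r) = U.indicator (fun _ ↦ φ r) y := by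
      intro y
      by_cases hy : y ∈ U
      · rw [indicator_of_mem hy, ← hμ y r]
        congr 1
        ext x
        simp [s, hy, dist_comm]
      · simp [s, hy]
    simp_rw [hy, hs_slice] at h
    rw [h, lintegral_indicator_const hU.measurableSet]
  have hlim : ∀ x ∈ U, 1 ≤ liminf (fun k ↦ ν (U ∩ ball x (u k)) / ψ (u k)) atTop := by
    intro x hx
    obtain ⟨ε, hε, hball⟩ := Metric.isOpen_iff.1 hU x hx
    refine le_liminf_of_le (by isBoundedDefault) ?_
    filter_upwards [hu0.eventually (gt_mem_nhds hε)] with k hk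
    rw [inter_eq_right.2 ((ball_subset_ball hk.le).trans hball), hν,
      ENNReal.div_self (hψ0 k) (hψt k)]
  calc μ U = ∫⁻ _ in U, 1 ∂μ := by simp
    _ ≤ ∫⁻ x in U, liminf (fun k ↦ ν (U ∩ ball x (u k)) / ψ (u k)) atTop ∂μ :=
      setLIntegral_mono' hU.measurableSet hlim
    _ ≤ liminf (fun k ↦ ∫⁻ x in U, ν (U ∩ ball x (u k)) / ψ (u k) ∂μ) atTop :=
      lintegral_liminf_le fun k ↦ (hmeas (u k)).div_const _
    _ ≤ ν U := by
      refine liminf_le_of_frequently_le' (Frequently.of_forall fun k ↦ ?_)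
      calc ∫⁻ x in U, ν (U ∩ ball x (u k)) / ψ (u k) ∂μ
          ≤ ∫⁻ x, ν (U ∩ ball x (u k)) / ψ (u k) ∂μ := setLIntegral_le_lintegral _ _
        _ = φ (u k) * ν U / ψ (u k) := by
          simp_rw [div_eq_mul_inv]
          rw [lintegral_mul_const _ (hmeas _), hint]
        _ ≤ ψ (u k) * ν U / ψ (u k) := by gcongr; exact hle k
        _ = ν U := by rw [mul_comm, ENNReal.mul_div_cancel_right (hψ0 k) (hψt k)]

theorem isOpenPosMeasure_of_measure_ball_eq {X : Type*} [PseudoMetricSpace X]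
    [SecondCountableTopology X] [MeasurableSpace X] {μ : Measure X} (h0 : μ ≠ 0)
    (hμ : ∀ x y r, μ (ball x r) = μ (ball y r)) : μ.IsOpenPosMeasure where
  open_pos U hU hne hzero := by
    obtain ⟨x, hx⟩ := hne
    obtain ⟨ε, hε, hball⟩ := Metric.isOpen_iff.1 hU x hx
    refine h0 (Measure.measure_univ_eq_zero.1 ?_)
    refine measure_null_of_locally_null _ fun y _ ↦ ⟨ball y ε, ?_, ?_⟩
    · exact mem_nhdsWithin_of_mem_nhds (ball_mem_nhds y hε)
    · rw [hμ y x]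
      exact measure_mono_null hball hzero

/-- **Christensen's uniqueness theorem**: two probability measures on a separable metric space
for which the measure of a ball depends only on its radius coincide. -/
theorem eq_of_measure_ball_eq {X : Type*} [PseudoMetricSpace X]
    [SecondCountableTopology X] [MeasurableSpace X] [BorelSpace X] (μ ν : Measure X)
    [IsProbabilityMeasure μ] [IsProbabilityMeasure ν]
    (hμ : ∀ x y r, μ (ball x r) = μ (ball y r)) (hν : ∀ x y r, ν (ball x r) = ν (ball y r)) :
    μ = ν := by
  obtain ⟨x₀⟩ : Nonempty X := nonempty_of_isProbabilityMeasure μ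
  wlog hfreq : ∃ᶠ k : ℕ in atTop,
      μ (ball x₀ (1 / ((k : ℝ) + 1))) ≤ ν (ball x₀ (1 / ((k : ℝ) + 1))) generalizing μ ν
  · refine (this ν μ hν hμ ?_).symm
    rw [not_frequently] at hfreq
    exact (hfreq.mono fun k hk ↦ (not_le.1 hk).le).frequently
  obtain ⟨g, hg, hgle⟩ := extraction_of_frequently_atTop hfreq
  have := isOpenPosMeasure_of_measure_ball_eq (IsProbabilityMeasure.ne_zero ν) hν
  have hopen : ∀ U, IsOpen U → μ U ≤ ν U := fun U hU ↦
    measure_le_of_isOpen_of_measure_ball_le μ ν (fun x r ↦ hμ x x₀ r) (fun x r ↦ hν x x₀ r)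
      (u := fun k ↦ 1 / ((g k : ℝ) + 1)) (fun k ↦ by positivity)
      (tendsto_one_div_add_atTop_nhds_zero_nat.comp hg.tendsto_atTop) hgle hU
  refine Measure.eq_of_le_of_isProbabilityMeasure (Measure.le_iff'.2 fun s ↦ ?_)
  rw [s.measure_eq_iInf_isOpen ν]
  refine le_iInf₂ fun U hsU ↦ le_iInf fun hU ↦ (measure_mono hsU).trans (hopen U hU)

section
variable {E : Type*} [NormedAddCommGroup E] [InnerProductSpace ℝ E]

/-- The distance from the origin, in the unit direction `w`, at which the ray leaves the closed
unit ball centred at `k`. -/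
noncomputable def exitRadius (w k : E) : ℝ := ⟪w, k⟫ + √(1 - ‖k‖ ^ 2 + ⟪w, k⟫ ^ 2)

theorem exitRadius_zero (w : E) : exitRadius w 0 = 1 := by simp [exitRadius]

theorem continuous_exitRadius (k : E) : Continuous fun w : E ↦ exitRadius w k := by
  unfold exitRadius
  fun_prop

theorem exitRadius_pos {k : E} (hk : ‖k‖ < 1) (w : E) : 0 < exitRadius w k := by
  have h : √(⟪w, k⟫ ^ 2) < √(1 - ‖k‖ ^ 2 + ⟪w, k⟫ ^ 2) :=
    Real.sqrt_lt_sqrt (sq_nonneg _) (by nlinarith [norm_nonneg k])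
  rw [Real.sqrt_sq_eq_abs] at h
  have := neg_abs_le ⟪w, k⟫
  unfold exitRadius
  linarith

theorem norm_smul_sub_sq {w : E} (hw : ‖w‖ = 1) (k : E) (r : ℝ) :
    ‖r • w - k‖ ^ 2 = r ^ 2 - 2 * r * ⟪w, k⟫ + ‖k‖ ^ 2 := by
  rw [norm_sub_sq_real, norm_smul, real_inner_smul_left, hw, mul_one, Real.norm_eq_abs, sq_abs]
  ring

theorem smul_mem_closedBall_iff_le_exitRadius {w k : E} (hw : ‖w‖ = 1) (hk : ‖k‖ < 1) {r : ℝ}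
    (hr : 0 < r) : r • w ∈ closedBall k 1 ↔ r ≤ exitRadius w k := by
  have hpos : 0 < 1 - ‖k‖ ^ 2 := by nlinarith [norm_nonneg k]
  rw [mem_closedBall, dist_eq_norm, ← sq_le_one_iff₀ (norm_nonneg _), norm_smul_sub_sq hw]
  have hsq : √(1 - ‖k‖ ^ 2 + ⟪w, k⟫ ^ 2) ^ 2 = 1 - ‖k‖ ^ 2 + ⟪w, k⟫ ^ 2 :=
    Real.sq_sqrt (by positivity)
  have hexit := exitRadius_pos hk w
  have hlt : ⟪w, k⟫ < √(1 - ‖k‖ ^ 2 + ⟪w, k⟫ ^ 2) :=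
    Real.lt_sqrt_of_sq_lt (by linarith)
  unfold exitRadius at hexit ⊢
  set s := √(1 - ‖k‖ ^ 2 + ⟪w, k⟫ ^ 2)
  have key : r ^ 2 - 2 * r * ⟪w, k⟫ + ‖k‖ ^ 2 - 1 =
      (r - (⟪w, k⟫ + s)) * (r + (s - ⟪w, k⟫)) := by
    linear_combination hsq
  have hfac : 0 < r + (s - ⟪w, k⟫) := by linarith
  constructor
  · intro h
    by_contra! hlt'
    nlinarith [mul_pos (sub_pos.2 hlt') hfac]
  · intro h
    nlinarith [mul_nonneg (sub_nonneg.2 h) hfac.le]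

theorem abs_exitRadius_sub_one_le {w k : E} (hw : ‖w‖ = 1) (hk : ‖k‖ < 1) :
    |exitRadius w k - 1| ≤ ‖k‖ := by
  have hpos : 0 < 1 - ‖k‖ ^ 2 := by nlinarith [norm_nonneg k]
  have hexit := exitRadius_pos hk w
  have hone : ‖exitRadius w k • w - k‖ = 1 := by
    rw [← sq_eq_sq₀ (norm_nonneg _) zero_le_one, norm_smul_sub_sq hw]
    have hsq : √(1 - ‖k‖ ^ 2 + ⟪w, k⟫ ^ 2) ^ 2 = 1 - ‖k‖ ^ 2 + ⟪w, k⟫ ^ 2 :=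
      Real.sq_sqrt (by positivity)
    unfold exitRadius
    linear_combination hsq
  have h := abs_norm_sub_norm_le (exitRadius w k • w) (exitRadius w k • w - k)
  rwa [hone, sub_sub_cancel, norm_smul, hw, mul_one, Real.norm_of_nonneg hexit.le] at h

theorem hasFDerivAt_exitRadius_zero (w : E) :
    HasFDerivAt (exitRadius w) (innerSL ℝ w) 0 := by
  have h1 : HasFDerivAt (fun k : E ↦ ⟪w, k⟫) (innerSL ℝ w) 0 := (innerSL ℝ w).hasFDerivAt
  have h2 : HasFDerivAt (fun k : E ↦ 1 - ‖k‖ ^ 2 + ⟪w, k⟫ ^ 2) (0 : E →L[ℝ] ℝ) 0 := by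
    have h3 : HasFDerivAt (fun k : E ↦ ‖k‖ ^ 2) (2 • innerSL ℝ (0 : E)) 0 :=
      (hasStrictFDerivAt_norm_sq (0 : E)).hasFDerivAt
    exact ((h3.const_sub 1).add (h1.pow 2)).congr_fderiv (by simp)
  exact (h1.add (h2.sqrt (by simp))).congr_fderiv (by simp)

variable [MeasurableSpace E] [BorelSpace E] [FiniteDimensional ℝ E] [Nontrivial E]

theorem integral_eq_integral_toSphere (μ : Measure E) [μ.IsAddHaarMeasure] {F : E → ℝ}
    (hF : Integrable F μ) :
    ∫ z, F z ∂μ = ∫ w : sphere (0 : E) 1,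
      (∫ r in Ioi (0 : ℝ), r ^ (finrank ℝ E - 1) * F (r • (w : E))) ∂μ.toSphere := by
  have hmp := μ.measurePreserving_homeomorphUnitSphereProd
  have hemb := (homeomorphUnitSphereProd E).measurableEmbedding
  let G : sphere (0 : E) 1 × Ioi (0 : ℝ) → ℝ := fun p ↦ F ((p.2 : ℝ) • (p.1 : E))
  have hG : ∀ x : ({0}ᶜ : Set E), G (homeomorphUnitSphereProd E x) = F x := by
    intro x
    have hx : ‖(x : E)‖ ≠ 0 := norm_ne_zero_iff.2 x.2
    simp [G, smul_smul, hx]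
  have hint : Integrable G (μ.toSphere.prod (.volumeIoiPow (finrank ℝ E - 1))) := by
    rw [← hmp.integrable_comp_emb hemb]
    have : G ∘ homeomorphUnitSphereProd E = F ∘ Subtype.val := funext hG
    rw [this, ← integrableOn_iff_comap_subtypeVal (measurableSet_singleton _).compl]
    exact hF.integrableOn
  calc ∫ z, F z ∂μ = ∫ x : ({0}ᶜ : Set E), F x ∂(μ.comap (↑)) := by
        rw [integral_subtype_comap (measurableSet_singleton _).compl F, restrict_compl_singleton]
    _ = ∫ p, G p ∂(μ.toSphere.prod (.volumeIoiPow (finrank ℝ E - 1))) := by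
        rw [← hmp.integral_comp hemb]
        simp_rw [hG]
    _ = ∫ w, ∫ r, G (w, r) ∂(.volumeIoiPow (finrank ℝ E - 1)) ∂μ.toSphere := integral_prod _ hint
    _ = _ := by
        refine integral_congr_ae (.of_forall fun w ↦ ?_)
        simp only [Measure.volumeIoiPow, ENNReal.ofReal]
        rw [integral_withDensity_eq_integral_smul
            (measurable_subtype_coe.pow_const _).real_toNNReal,
          integral_subtype_comap measurableSet_Ioi
            fun a ↦ Real.toNNReal (a ^ (finrank ℝ E - 1)) • F (a • (w : E)),
          setIntegral_congr_fun measurableSet_Ioi fun x hx ↦ ?_]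
        simp only [NNReal.smul_def, Real.coe_toNNReal _ (pow_nonneg (mem_Ioi.1 hx).le _),
          smul_eq_mul]

theorem setIntegral_closedBall_add_eq (μ : Measure E) [μ.IsAddHaarMeasure] {g : E → ℝ}
    (hg : Continuous g) {k : E} (hk : ‖k‖ < 1) :
    ∫ z in closedBall 0 1, g (k + z) ∂μ = ∫ w : sphere (0 : E) 1,
      (∫ r in (0 : ℝ)..exitRadius (w : E) k,
        r ^ (finrank ℝ E - 1) * g (r • (w : E))) ∂μ.toSphere := by
  have hint : Integrable ((closedBall k 1).indicator g) μ :=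
    (hg.continuousOn.integrableOn_compact (isCompact_closedBall k 1)).integrable_indicator
      measurableSet_closedBall
  have htrans : ∫ z in closedBall 0 1, g (k + z) ∂μ = ∫ z, (closedBall k 1).indicator g z ∂μ := by
    rw [← integral_indicator measurableSet_closedBall,
      ← integral_add_left_eq_self (μ := μ) ((closedBall k 1).indicator g) k]
    congr 1 with z
    simp [indicator, dist_eq_norm]
  rw [htrans, integral_eq_integral_toSphere μ hint]
  refine integral_congr_ae (.of_forall fun w ↦ ?_)
  have hw : ‖(w : E)‖ = 1 := by simp
  have hpos := exitRadius_pos hk (w : E)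
  simp only
  rw [intervalIntegral.integral_of_le hpos.le, ← Ioi_inter_Iic,
    ← setIntegral_indicator measurableSet_Iic]
  refine setIntegral_congr_fun measurableSet_Ioi fun r hr ↦ ?_
  simp only [indicator, smul_mem_closedBall_iff_le_exitRadius hw hk hr, mem_Iic]
  split_ifs <;> simp

theorem hasGradientAt_setIntegral_closedBall_add (μ : Measure E) [μ.IsAddHaarMeasure] {g : E → ℝ}
    (hg : Continuous g) :
    HasGradientAt (fun k ↦ ∫ z in closedBall 0 1, g (k + z) ∂μ)
      (∫ w : sphere (0 : E) 1, g w • (w : E) ∂μ.toSphere) 0 := by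
  set d := finrank ℝ E - 1
  let F : E → sphere (0 : E) 1 → ℝ := fun k w ↦
    ∫ r in (0 : ℝ)..exitRadius (w : E) k, r ^ d * g (r • (w : E))
  have hcont : ∀ w : E, Continuous fun r : ℝ ↦ r ^ d * g (r • w) := fun w ↦ by fun_prop
  have hFcont : ∀ k, Continuous (F k) := fun k ↦
    intervalIntegral.continuous_parametric_intervalIntegral_of_continuous
      (f := fun (w : sphere (0 : E) 1) (r : ℝ) ↦ r ^ d * g (r • (w : E))) (by fun_prop)
      ((continuous_exitRadius k).comp continuous_subtype_val)
  obtain ⟨M, hM⟩ := (isCompact_closedBall (0 : E) 2).exists_bound_of_continuousOn hg.continuousOn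
  have hM0 : 0 ≤ M := (norm_nonneg _).trans (hM 0 (by simp))
  have hF'cont : Continuous fun w : sphere (0 : E) 1 ↦ g w • innerSL ℝ (w : E) := by fun_prop
  have hlip : ∀ w, ∀ k ∈ ball (0 : E) 1, ‖F k w - F 0 w‖ ≤ 2 ^ d * M * ‖k - 0‖ := by
    intro w k hk
    rw [mem_ball_zero_iff] at hk
    have hw : ‖(w : E)‖ = 1 := by simp
    have hρ := abs_exitRadius_sub_one_le hw hk
    simp only [F, exitRadius_zero, sub_zero]
    rw [intervalIntegral.integral_interval_sub_left ((hcont w).intervalIntegrable _ _)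
      ((hcont w).intervalIntegrable _ _)]
    refine (intervalIntegral.norm_integral_le_of_norm_le_const (C := 2 ^ d * M)
      fun r hr ↦ ?_).trans (by gcongr)
    have hr0 : 0 ≤ r ∧ r ≤ 2 := by
      have := exitRadius_pos hk (w : E)
      rw [abs_le] at hρ
      rw [uIoc, mem_Ioc] at hr
      exact ⟨(le_min zero_le_one this.le).trans hr.1.le,
        hr.2.trans (max_le one_le_two (by linarith))⟩
    rw [norm_mul, norm_pow, Real.norm_of_nonneg hr0.1]
    have hgM : ‖g (r • (w : E))‖ ≤ M :=
      hM _ (by simp [norm_smul, abs_of_nonneg hr0.1, hr0.2])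
    exact mul_le_mul (pow_le_pow_left₀ hr0.1 hr0.2 d) hgM (norm_nonneg _) (by positivity)
  have hdiff : ∀ w, HasFDerivAt (F · w) (g w • innerSL ℝ (w : E)) 0 := by
    intro w
    have h := intervalIntegral.integral_hasDerivAt_right
      ((hcont w).intervalIntegrable 0 (exitRadius (w : E) 0))
      ((hcont w).stronglyMeasurableAtFilter _ _) (hcont w).continuousAt
    exact (h.comp_hasFDerivAt (0 : E) (hasFDerivAt_exitRadius_zero (w : E))).congr_fderiv
      (by simp [exitRadius_zero])
  have hderiv := (hasFDerivAt_integral_of_dominated_loc_of_lip' (μ := μ.toSphere)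
    (ball_mem_nhds (0 : E) one_pos) (fun k _ ↦ (hFcont k).aestronglyMeasurable)
    ((hFcont 0).integrable_of_hasCompactSupport (.of_compactSpace _))
    hF'cont.aestronglyMeasurable (.of_forall hlip) (integrable_const _) (.of_forall hdiff))
  rw [hasGradientAt_iff_hasFDerivAt]
  have hcongr : (fun k ↦ ∫ z in closedBall 0 1, g (k + z) ∂μ) =ᶠ[𝓝 0]
      fun k ↦ ∫ w, F k w ∂μ.toSphere := by
    filter_upwards [ball_mem_nhds (0 : E) one_pos] with k hk
    exact setIntegral_closedBall_add_eq μ hg (mem_ball_zero_iff.1 hk)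
  refine (hderiv.2.congr_of_eventuallyEq hcongr).congr_fderiv ?_
  ext v
  have hint : Integrable (fun w : sphere (0 : E) 1 ↦ g w • (w : E)) μ.toSphere :=
    Continuous.integrable_of_hasCompactSupport (by fun_prop) (.of_compactSpace _)
  rw [ContinuousLinearMap.integral_apply hderiv.1, InnerProductSpace.toDual_apply_apply,
    real_inner_comm, ← integral_inner hint]
  simp [real_inner_smul_right, real_inner_comm]
end

section
variable {E : Type*} [NormedAddCommGroup E] [InnerProductSpace ℝ E]

theorem exists_linearIsometryEquiv_image_ball_eq (x y : sphere (0 : E) 1) :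
    ∃ L : E ≃ₗᵢ[ℝ] E, ∀ r, ((↑) '' ball y r : Set E) = L '' ((↑) '' ball x r) := by
  let L := (ℝ ∙ ((x : E) - y))ᗮ.reflection
  have hL : L x = y := Submodule.reflection_sub (by simp)
  refine ⟨L, fun r ↦ ?_⟩
  have hball : ∀ z : sphere (0 : E) 1, ((↑) '' ball z r : Set E) = ball (z : E) r ∩ sphere 0 1 :=
    fun z ↦ by ext; simp [Subtype.image_ball]
  rw [hball, hball, image_inter L.injective, L.image_ball, L.image_sphere, hL, map_zero]

theorem hausdorffMeasure_sphere_ball_eq [MeasurableSpace E] [BorelSpace E] {d : ℝ} (hd : 0 ≤ d)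
    (x y : sphere (0 : E) 1) (r : ℝ) : μH[d] (ball x r) = μH[d] (ball y r) := by
  obtain ⟨L, hL⟩ := exists_linearIsometryEquiv_image_ball_eq x y
  rw [← isometry_subtype_coe.hausdorffMeasure_image (.inl hd) (ball x r),
    ← isometry_subtype_coe.hausdorffMeasure_image (.inl hd) (ball y r), hL]
  exact (L.toIsometryEquiv.hausdorffMeasure_image d _).symm

theorem toSphere_volume_ball_eq [MeasurableSpace E] [BorelSpace E] [FiniteDimensional ℝ E]
    (x y : sphere (0 : E) 1) (r : ℝ) :
    (volume : Measure E).toSphere (ball x r) = (volume : Measure E).toSphere (ball y r) := by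
  obtain ⟨L, hL⟩ := exists_linearIsometryEquiv_image_ball_eq x y
  have himage : Ioo (0 : ℝ) 1 • (L '' ((↑) '' ball x r)) =
      L '' (Ioo (0 : ℝ) 1 • ((↑) '' ball x r)) :=
    (image_image2_distrib_right fun a z ↦ L.map_smul a z).symm
  rw [Measure.toSphere_apply' _ measurableSet_ball, Measure.toSphere_apply' _ measurableSet_ball,
    hL, himage, ← L.measurePreserving.measure_preimage_emb L.toHomeomorph.measurableEmbedding
      (L '' _), preimage_image_eq _ L.injective]
end

theorem lipschitzOnWith_normalize {E : Type*} [NormedAddCommGroup E] [NormedSpace ℝ E] :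
    LipschitzOnWith 2 (fun x : E ↦ ‖x‖⁻¹ • x) {x | 1 ≤ ‖x‖} := by
  refine LipschitzOnWith.of_dist_le_mul fun x hx y hy ↦ ?_
  have hx' : 1 ≤ ‖x‖ := hx
  have hx0 : 0 < ‖x‖ := by linarith
  have hy0 : 0 < ‖y‖ := one_pos.trans_le hy
  have key : ‖x‖⁻¹ • x - ‖y‖⁻¹ • y = ‖x‖⁻¹ • ((x - y) + (‖y‖ - ‖x‖) • (‖y‖⁻¹ • y)) := by
    rw [smul_add, sub_smul, smul_smul ‖y‖, mul_inv_cancel₀ hy0.ne', one_smul, smul_sub, smul_sub,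
      smul_smul ‖x‖⁻¹ ‖x‖, inv_mul_cancel₀ hx0.ne', one_smul]
    abel
  have hunit : ‖‖y‖⁻¹ • y‖ = 1 := by rw [norm_smul, norm_inv, norm_norm, inv_mul_cancel₀ hy0.ne']
  rw [dist_eq_norm, dist_eq_norm, key, norm_smul, norm_inv, norm_norm]
  calc ‖x‖⁻¹ * ‖(x - y) + (‖y‖ - ‖x‖) • (‖y‖⁻¹ • y)‖
      ≤ 1 * (‖x - y‖ + ‖x - y‖) := by
        gcongr
        · exact inv_le_one_of_one_le₀ hx'
        · refine (norm_add_le _ _).trans ?_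
          rw [norm_smul, hunit, mul_one, Real.norm_eq_abs, norm_sub_rev x y]
          gcongr
          exact abs_norm_sub_norm_le y x
    _ = ((2 : ℝ≥0) : ℝ) * ‖x - y‖ := by push_cast; ring

theorem hausdorffMeasure_sphere_lt_top (m : ℕ) :
    μH[m] (sphere (0 : EuclideanSpace ℝ (Fin (m + 1))) 1) < ∞ := by
  let e : Fin (m + 1) → ℝ → (Fin m → ℝ) → EuclideanSpace ℝ (Fin (m + 1)) := fun i s y ↦
    WithLp.toLp 2 (i.insertNth s y)
  let face : Fin (m + 1) → ℝ → Set (EuclideanSpace ℝ (Fin (m + 1))) := fun i s ↦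
    (fun y ↦ ‖e i s y‖⁻¹ • e i s y) '' Icc (-1) 1
  have hcover : sphere (0 : EuclideanSpace ℝ (Fin (m + 1))) 1 ⊆ ⋃ i, face i 1 ∪ face i (-1) := by
    intro x hx
    have hx1 : ‖x‖ = 1 := by simpa using hx
    obtain ⟨i, -, hi⟩ := Finset.exists_max_image Finset.univ (fun i ↦ |x i|) Finset.univ_nonempty
    have hi0 : 0 < |x i| := by
      by_contra! h
      have : x = 0 := by
        ext j
        simpa using (hi j (Finset.mem_univ j)).trans h
      simp [this] at hx1
    have hface : x ∈ face i (x i / |x i|) := by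
      refine ⟨fun j ↦ x (i.succAbove j) / |x i|, ?_, ?_⟩
      · have h : ∀ j, |x (i.succAbove j) / (|x i|)| ≤ 1 := fun j ↦ by
          rw [abs_div, abs_abs]
          exact div_le_one_of_le₀ (hi _ (Finset.mem_univ _)) hi0.le
        exact ⟨fun j ↦ (abs_le.1 (h j)).1, fun j ↦ (abs_le.1 (h j)).2⟩
      · have he : e i (x i / |x i|) (fun j ↦ x (i.succAbove j) / |x i|) = |x i|⁻¹ • x := by
          ext j
          refine Fin.succAboveCases i ?_ (fun j ↦ ?_) j <;> simp [e, div_eq_inv_mul]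
        simp only [he, norm_smul, hx1, smul_smul]
        simp [hi0.ne']
    refine mem_iUnion.2 ⟨i, ?_⟩
    rcases (abs_pos.1 hi0).lt_or_gt with h | h
    · right
      rwa [abs_of_neg h, div_neg, div_self h.ne] at hface
    · left
      rwa [abs_of_pos h, div_self h.ne'] at hface
  have hface : ∀ i s, |s| = 1 → μH[m] (face i s) < ∞ := by
    intro i s hs
    have hins : LipschitzWith 1 fun y : Fin m → ℝ ↦ (i.insertNth s y : Fin (m + 1) → ℝ) := by
      refine LipschitzWith.of_dist_le_mul fun y z ↦ ?_
      rw [NNReal.coe_one, one_mul]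
      refine (dist_pi_le_iff dist_nonneg).2 fun j ↦ ?_
      refine Fin.succAboveCases i ?_ (fun j ↦ ?_) j
      · simp
      · simpa using dist_le_pi_dist y z j
    have he := (PiLp.lipschitzWith_toLp 2 fun _ : Fin (m + 1) ↦ ℝ).comp hins
    have hnorm : ∀ y, 1 ≤ ‖e i s y‖ := fun y ↦ by
      simpa [e, hs] using PiLp.norm_apply_le (e i s y) i
    have hlip := lipschitzOnWith_normalize.comp (he.lipschitzOnWith (s := Icc (-1) 1))
      (fun y _ ↦ hnorm y)
    refine (hlip.hausdorffMeasure_image_le (Nat.cast_nonneg m)).trans_lt ?_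
    refine ENNReal.mul_lt_top
      (ENNReal.rpow_lt_top_of_nonneg (Nat.cast_nonneg m) ENNReal.coe_ne_top) ?_
    have hvol := hausdorffMeasure_pi_real (ι := Fin m)
    rw [Fintype.card_fin] at hvol
    rw [hvol]
    exact isCompact_Icc.measure_lt_top
  refine (measure_mono hcover).trans_lt ((measure_iUnion_fintype_le _ _).trans_lt ?_)
  refine ENNReal.sum_lt_top.2 fun i _ ↦ (measure_union_le _ _).trans_lt ?_
  exact ENNReal.add_lt_top.2 ⟨hface i 1 (by simp), hface i (-1) (by simp)⟩

theorem hausdorffMeasure_sphere_pos (m : ℕ) :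
    0 < μH[m] (sphere (0 : EuclideanSpace ℝ (Fin (m + 1))) 1) := by
  let p : EuclideanSpace ℝ (Fin (m + 1)) → Fin m → ℝ := fun x j ↦ x j.succ
  have hp : LipschitzWith 1 p := by
    refine LipschitzWith.of_dist_le_mul fun x y ↦ ?_
    rw [NNReal.coe_one, one_mul]
    refine (dist_pi_le_iff dist_nonneg).2 fun j ↦ ?_
    simpa [p, dist_eq_norm] using PiLp.norm_apply_le (x - y) j.succ
  let U : Set (Fin m → ℝ) := {y | ∑ j, y j ^ 2 < 1}
  have hU : IsOpen U := isOpen_lt (by fun_prop) continuous_const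
  have hsub : U ⊆ p '' sphere 0 1 := by
    intro y hy
    have hy' : ∑ j, y j ^ 2 < 1 := hy
    refine ⟨WithLp.toLp 2 (Fin.cons √(1 - ∑ j, y j ^ 2) y), ?_, by ext; simp [p]⟩
    rw [mem_sphere_zero_iff_norm, EuclideanSpace.norm_eq, Fin.sum_univ_succ]
    simp [Real.sq_sqrt (sub_nonneg.2 hy'.le)]
  have hvol := hausdorffMeasure_pi_real (ι := Fin m)
  rw [Fintype.card_fin] at hvol
  calc (0 : ℝ≥0∞) < volume U := hU.measure_pos _ ⟨0, by simp [U]⟩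
    _ = μH[m] U := by rw [hvol]
    _ ≤ μH[m] (p '' sphere 0 1) := measure_mono hsub
    _ ≤ μH[m] (sphere (0 : EuclideanSpace ℝ (Fin (m + 1))) 1) := by
      simpa using hp.hausdorffMeasure_image_le (Nat.cast_nonneg m) (sphere 0 1)

theorem uniformUnitSphere_succ_eq_map_toSphere (m : ℕ) :
    uniformUnitSphere (m + 1) =
      ((volume : Measure (EuclideanSpace ℝ (Fin (m + 1)))).toSphere univ)⁻¹ •
        (volume : Measure (EuclideanSpace ℝ (Fin (m + 1)))).toSphere.map (↑) := by
  set σ := (volume : Measure (EuclideanSpace ℝ (Fin (m + 1)))).toSphere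
  let η : Measure (sphere (0 : EuclideanSpace ℝ (Fin (m + 1))) 1) := μH[m]
  have hmap : η.map (↑) = (μH[m]).restrict (sphere (0 : EuclideanSpace ℝ (Fin (m + 1))) 1) := by
    rw [isometry_subtype_coe.map_hausdorffMeasure (.inl (Nat.cast_nonneg m)), Subtype.range_coe]
  have huniv : η univ = μH[m] (sphere (0 : EuclideanSpace ℝ (Fin (m + 1))) 1) := by
    rw [← isometry_subtype_coe.hausdorffMeasure_image (.inl (Nat.cast_nonneg m)), image_univ,
      Subtype.range_coe]
  have : IsFiniteMeasure η := ⟨huniv ▸ hausdorffMeasure_sphere_lt_top m⟩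
  have : NeZero η := ⟨fun h ↦ (hausdorffMeasure_sphere_pos m).ne' (by rw [← huniv, h]; rfl)⟩
  have : NeZero σ := ⟨Measure.toSphere_ne_zero _⟩
  have key : (η univ)⁻¹ • η = (σ univ)⁻¹ • σ :=
    eq_of_measure_ball_eq _ _
      (fun x y r ↦ by simp [η, hausdorffMeasure_sphere_ball_eq (Nat.cast_nonneg m) x y r])
      (fun x y r ↦ by simp [σ, toSphere_volume_ball_eq x y r])
  have hcast : ((m + 1 : ℕ) : ℝ) - 1 = m := by push_cast; ring
  rw [uniformUnitSphere, hcast, ← hmap, ← huniv, ← Measure.map_smul, key, Measure.map_smul]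

/-- **Sphere-sampling gradient formula for the ball smoothing** (Lemma 3 of the paper,
Lemma 6.5 in Hazan's book).  Let `f : ℝⁿ → ℝ` be continuous and `δ > 0`.  Then the
`δ`-smoothing `f̂_δ` is differentiable and
`∇f̂_δ(x) = E_{u ∼ Sⁿ}[(n/δ) f(x + δu) u]`. -/
theorem gradient_of_delta_smoothing
    (n : ℕ) (δ : ℝ) (hδ : 0 < δ)
    (f : EuclideanSpace ℝ (Fin n) → ℝ) (hf : Continuous f)
    (x : EuclideanSpace ℝ (Fin n)) :
    HasGradientAt (deltaSmoothed n f δ)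
      (∫ u, (((n : ℝ) / δ) * f (x + δ • u)) • u ∂(uniformUnitSphere n)) x := by
  obtain _ | m := n
  · rw [hasGradientAt_iff_hasFDerivAt]
    exact (hasFDerivAt_of_subsingleton _ _).congr_fderiv (Subsingleton.elim _ _)
  have hg : Continuous fun u ↦ f (x + δ • u) := by fun_prop
  have hbase := (hasGradientAt_setIntegral_closedBall_add volume hg).hasFDerivAt
  have hscale : HasFDerivAt (fun y ↦ δ⁻¹ • (y - x)) (δ⁻¹ • ContinuousLinearMap.id ℝ _) x :=
    ((hasFDerivAt_id x).sub_const x).const_smul δ⁻¹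
  have hcomp := (HasFDerivAt.comp x (by rwa [sub_self, smul_zero]) hscale).const_smul
    ((volume.real (closedBall (0 : EuclideanSpace ℝ (Fin (m + 1))) 1))⁻¹)
  rw [hasGradientAt_iff_hasFDerivAt]
  refine (hcomp.congr_of_eventuallyEq (.of_forall fun y ↦ ?_)).congr_fderiv ?_
  · simp only [deltaSmoothed, uniformUnitBall, integral_smul_measure, ENNReal.toReal_inv,
      Function.comp_apply, Pi.smul_apply, measureReal_def]
    congr 2 with u
    rw [smul_add, smul_smul, mul_inv_cancel₀ hδ.ne', one_smul]
    congr 1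
    abel
  · rw [uniformUnitSphere_succ_eq_map_toSphere, integral_smul_measure,
      (MeasurableEmbedding.subtype_coe isClosed_sphere.measurableSet).integral_map,
      ENNReal.toReal_inv, ← measureReal_def, Measure.toSphere_real_apply_univ,
      measureReal_def volume (ball 0 1), ← Measure.addHaar_closedBall_eq_addHaar_ball,
      ← measureReal_def]
    have hvol : volume.real (closedBall (0 : EuclideanSpace ℝ (Fin (m + 1))) 1) ≠ 0 :=
      (ENNReal.toReal_pos (measure_closedBall_pos _ _ one_pos).ne' measure_closedBall_lt_top.ne).ne'
    simp_rw [mul_smul]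
    rw [integral_smul]
    ext v
    simp
    field_simp
end

section
/- (Per-iteration decrease of conditional gradient with line search.) Let C ⊂ ℝⁿ be a compact convex set whose diameter is at most 2R, let F : ℝⁿ → ℝ be convex and 2-smooth over C with minimizer x* over C, and let z ∈ C. Let v ∈ argmin_{x∈C} ∇F(z)⊤x, let g = ∇F(z)⊤(z − v) denote the duality gap, let σ ∈ argmin_{σ'∈[0,1]} F(z + σ'(v − z)), and set z⁺ = z + σ(v − z). Then F(z⁺) − F(x*) ≤ (F(z) − F(x*)) − min{ (g/(4R))², g/2 }. -/
open scoped RealInnerProductSpace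

/-- Maximizing the concave quadratic `s ↦ s g - 4 R² s²` over `[0, 1]` yields at least
`min ((g / (4R))²) (g / 2)`. -/
lemma exists_mem_Icc_min_le_quadratic {R g : ℝ} (hR : 0 < R) (hg : 0 ≤ g) :
    ∃ s ∈ Set.Icc (0 : ℝ) 1, min ((g / (4 * R)) ^ 2) (g / 2) ≤ s * g - s ^ 2 * (2 * R) ^ 2 := by
  rcases le_total g (8 * R ^ 2) with h | h
  · refine ⟨g / (8 * R ^ 2), ⟨by positivity, (div_le_one (by positivity)).2 h⟩, ?_⟩
    refine (min_le_left _ _).trans (le_of_eq ?_)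
    field_simp
    ring
  · refine ⟨1, ⟨zero_le_one, le_rfl⟩, (min_le_right _ _).trans ?_⟩
    nlinarith

/-- **Per-iteration decrease of conditional gradient with line search.**
Let `C ⊂ ℝⁿ` be a compact convex set of diameter at most `2R`, let `F : ℝⁿ → ℝ` be convex and
`2`-smooth over `C` (with gradient `F'`), with minimizer `x*` over `C`, and let `z ∈ C`.  Let
`v ∈ argmin_{x∈C} ∇F(z)⊤x`, let `g = ∇F(z)⊤(z − v)` be the duality gap, let
`σ ∈ argmin_{σ'∈[0,1]} F(z + σ'(v − z))`, and `z⁺ = z + σ(v − z)`.  Then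
`F(z⁺) − F(x*) ≤ (F(z) − F(x*)) − min ((g/(4R))²) (g/2)`. -/
theorem cg_line_search_decrease
    (n : ℕ) (C : Set (EuclideanSpace ℝ (Fin n))) (R : ℝ) (hR : 0 < R)
    (hCcompact : IsCompact C) (hCconvex : Convex ℝ C)
    (hdiam : ∀ x ∈ C, ∀ y ∈ C, ‖x - y‖ ≤ 2 * R)
    (F : EuclideanSpace ℝ (Fin n) → ℝ) (F' : EuclideanSpace ℝ (Fin n) → EuclideanSpace ℝ (Fin n))
    (hFconvex : ConvexOn ℝ Set.univ F)
    (hdiff : ∀ x ∈ C, HasGradientAt F (F' x) x)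
    (hsmooth : ∀ x ∈ C, ∀ y ∈ C, F y ≤ F x + ⟪F' x, y - x⟫ + ‖x - y‖ ^ 2)
    (xstar : EuclideanSpace ℝ (Fin n)) (hxstar : xstar ∈ C)
    (hmin : ∀ x ∈ C, F xstar ≤ F x)
    (z : EuclideanSpace ℝ (Fin n)) (hz : z ∈ C)
    (v : EuclideanSpace ℝ (Fin n)) (hv : v ∈ C)
    (hvmin : ∀ x ∈ C, ⟪F' z, v⟫ ≤ ⟪F' z, x⟫)
    (σ : ℝ) (hσ : σ ∈ Set.Icc (0 : ℝ) 1)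
    (hls : ∀ σ' ∈ Set.Icc (0 : ℝ) 1, F (z + σ • (v - z)) ≤ F (z + σ' • (v - z))) :
    F (z + σ • (v - z)) - F xstar ≤
      (F z - F xstar) - min ((⟪F' z, z - v⟫ / (4 * R)) ^ 2) (⟪F' z, z - v⟫ / 2) := by
  have hg : 0 ≤ ⟪F' z, z - v⟫ := by
    rw [inner_sub_right]
    linarith [hvmin z hz]
  obtain ⟨s, hs, hquad⟩ := exists_mem_Icc_min_le_quadratic hR hg
  have hsm := hsmooth z hz _ (hCconvex.add_smul_sub_mem hz hv hs)
  have hinner : ⟪F' z, z + s • (v - z) - z⟫ = -(s * ⟪F' z, z - v⟫) := by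
    rw [add_sub_cancel_left, inner_smul_right, ← neg_sub z v, inner_neg_right, mul_neg]
  have hnorm : ‖z - (z + s • (v - z))‖ ^ 2 ≤ s ^ 2 * (2 * R) ^ 2 := by
    rw [sub_add_cancel_left, norm_neg, norm_smul, mul_pow, Real.norm_eq_abs, sq_abs]
    gcongr
    exact hdiam v hv z hz
  linarith [hls s hs]
end

section
/- (Warm-start suboptimality after a linear update.) Let C ⊂ ℝⁿ be a compact convex set, let F : ℝⁿ → ℝ be 2-strongly convex and differentiable over C, let g ∈ ℝⁿ, η ≥ 0, and define F⁺(x) = F(x) + η g⊤x. Let x* = argmin_{x∈C} F(x) and y* = argmin_{x∈C} F⁺(x), and suppose x̄ ∈ C satisfies F(x̄) − F(x*) ≤ ε. Then F⁺(x̄) − F⁺(y*) ≤ ε + η‖g‖(‖x̄ − x*‖ + ‖x* − y*‖) ≤ ε + η‖g‖√ε + η²‖g‖². -/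
open scoped RealInnerProductSpace

/-- Quadratic growth at a constrained minimizer, from the strong convexity inequality there. -/
theorem sq_norm_sub_le_of_isMinOn {E : Type*} [NormedAddCommGroup E] [InnerProductSpace ℝ E]
    [CompleteSpace E] {C : Set E} (hC : Convex ℝ C) {F : E → ℝ} {v x y : E} (hx : x ∈ C)
    (hy : y ∈ C) (hF : HasGradientAt F v x) (hmin : IsMinOn F C x)
    (hstrong : F x + ⟪v, y - x⟫ + ‖x - y‖ ^ 2 ≤ F y) : ‖x - y‖ ^ 2 ≤ F y - F x := by
  have h := hmin.localize.hasFDerivWithinAt_nonneg hF.hasFDerivAt.hasFDerivWithinAt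
    (sub_mem_posTangentConeAt_of_segment_subset (hC.segment_subset hx hy))
  rw [InnerProductSpace.toDual_apply_apply] at h
  linarith

/-- **Warm-start suboptimality after a linear update.**
Let `C ⊂ ℝⁿ` be a compact convex set, let `F : ℝⁿ → ℝ` be `2`-strongly convex and differentiable
over `C` (with gradient `F'`), let `g ∈ ℝⁿ`, `η ≥ 0`, and define `F⁺(x) = F(x) + η g⊤x`.  Let
`x* = argmin_{x∈C} F(x)`, `y* = argmin_{x∈C} F⁺(x)`, and suppose `x̄ ∈ C` satisfies
`F(x̄) − F(x*) ≤ ε`.  Then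
`F⁺(x̄) − F⁺(y*) ≤ ε + η‖g‖(‖x̄ − x*‖ + ‖x* − y*‖) ≤ ε + η‖g‖√ε + η²‖g‖²`. -/
theorem warm_start_suboptimality
    (n : ℕ) (C : Set (EuclideanSpace ℝ (Fin n)))
    (hCcompact : IsCompact C) (hCconvex : Convex ℝ C)
    (F : EuclideanSpace ℝ (Fin n) → ℝ) (F' : EuclideanSpace ℝ (Fin n) → EuclideanSpace ℝ (Fin n))
    (hdiff : ∀ x ∈ C, HasGradientAt F (F' x) x)
    (hstrong : ∀ x ∈ C, ∀ y ∈ C, F y ≥ F x + ⟪F' x, y - x⟫ + ‖x - y‖ ^ 2)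
    (g : EuclideanSpace ℝ (Fin n)) (η : ℝ) (hη : 0 ≤ η)
    (ε : ℝ) (hε : 0 ≤ ε)
    (xstar : EuclideanSpace ℝ (Fin n)) (hxstar : xstar ∈ C)
    (hxmin : ∀ x ∈ C, F xstar ≤ F x)
    (ystar : EuclideanSpace ℝ (Fin n)) (hystar : ystar ∈ C)
    (hymin : ∀ x ∈ C, F ystar + η * ⟪g, ystar⟫ ≤ F x + η * ⟪g, x⟫)
    (xbar : EuclideanSpace ℝ (Fin n)) (hxbar : xbar ∈ C)
    (happrox : F xbar - F xstar ≤ ε) :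
    (F xbar + η * ⟪g, xbar⟫) - (F ystar + η * ⟪g, ystar⟫) ≤
        ε + η * ‖g‖ * (‖xbar - xstar‖ + ‖xstar - ystar‖) ∧
    ε + η * ‖g‖ * (‖xbar - xstar‖ + ‖xstar - ystar‖) ≤
        ε + η * ‖g‖ * Real.sqrt ε + η ^ 2 * ‖g‖ ^ 2 := by
  have hgrad : HasGradientAt (fun x => F x + η * ⟪g, x⟫) (F' ystar + η • g) ystar := by
    rw [hasGradientAt_iff_hasFDerivAt, map_add, map_smul]
    exact (hdiff ystar hystar).hasFDerivAt.add
      ((InnerProductSpace.toDual ℝ _ g).hasFDerivAt.const_mul η)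
  have hgrowth : ∀ y ∈ C, ‖xstar - y‖ ^ 2 ≤ F y - F xstar := fun y hy =>
    sq_norm_sub_le_of_isMinOn hCconvex hxstar hy (hdiff xstar hxstar) hxmin
      (hstrong xstar hxstar y hy)
  have hperturbed := sq_norm_sub_le_of_isMinOn hCconvex hystar hxstar hgrad hymin (by
    have := hstrong ystar hystar xstar hxstar
    rw [inner_add_left, real_inner_smul_left, inner_sub_right g]
    linarith)
  have hηg : 0 ≤ η * ‖g‖ := by positivity
  have hinner : ∀ x y, η * ⟪g, x⟫ - η * ⟪g, y⟫ ≤ η * ‖g‖ * ‖x - y‖ := fun x y => by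
    rw [← mul_sub, ← inner_sub_right, mul_assoc]
    exact mul_le_mul_of_nonneg_left (real_inner_le_norm _ _) hη
  have hbar : ‖xbar - xstar‖ ≤ √ε := by
    rw [norm_sub_rev]
    exact Real.le_sqrt_of_sq_le ((hgrowth xbar hxbar).trans happrox)
  have hstable : ‖xstar - ystar‖ ≤ η * ‖g‖ := by
    have h := hgrowth ystar hystar
    have hi := hinner xstar ystar
    rw [norm_sub_rev] at hperturbed
    nlinarith [norm_nonneg (xstar - ystar)]
  constructor
  · linarith [hinner xbar xstar, hinner xstar ystar, hxmin ystar hystar]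
  · nlinarith [mul_le_mul_of_nonneg_left hbar hηg, mul_le_mul_of_nonneg_left hstable hηg]
end
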